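/- Local weighted Fefferman–Stein inequality: let Q_0 ⊂ ℝ^n be a cube, 1 < p < ∞, w ∈ A_∞^d(Q_0) with constants C_w, δ_w > 0, and f ∈ L^1(Q_0). Then ∫_{Q_0} |f(x) − f_{Q_0}|^p w(x) dx ≤ C ∫_{Q_0} (M^{d,♯}_{Q_0} f(x))^p w(x) dx, where C = C(n, p, C_w, δ_w) > 0. -/

import Mathlib

open MeasureTheory ENNReal NNReal Set

noncomputable section

/-- Euclidean space `ℝ^n`. -/
abbrev Rn (n : ℕ) := EuclideanSpace ℝ (Fin n)

/-- The half-open cube with lower corner `a` and side length `l`: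
`Q = [a₁, a₁+l) × … × [aₙ, aₙ+l)`. -/
def Cube {n : ℕ} (a : Rn n) (l : ℝ) : Set (Rn n) :=
  {x | ∀ i, a i ≤ x i ∧ x i < a i + l}

/-- `IsDyadicSub a l Q` : `Q` belongs to the collection `D(Q₀)` of dyadic subcubes of the cube
`Q₀ = Cube a l`, i.e. `Q₀` together with all cubes obtained from `Q₀` by recursively
bisecting each edge. -/
def IsDyadicSub {n : ℕ} (a : Rn n) (l : ℝ) (Q : Set (Rn n)) : Prop :=
  ∃ (k : ℕ) (m : Fin n → ℕ), (∀ i, m i < 2 ^ k) ∧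
    Q = {x : Rn n | ∀ i, a i + l * m i / 2 ^ k ≤ x i ∧ x i < a i + l * m i / 2 ^ k + l / 2 ^ k}

/-- The weighted measure `w(E) = ∫_E w dx` of a set, as an extended nonnegative real. -/
def wMass {n : ℕ} (w : Rn n → ℝ) (E : Set (Rn n)) : ℝ≥0∞ :=
  ∫⁻ x in E, ENNReal.ofReal (w x)

/-- The dyadic Muckenhoupt `A_∞` condition on `Q₀ = Cube a l` with constants `Cw, δw`. -/
def IsAinftyD {n : ℕ} (a : Rn n) (l : ℝ) (w : Rn n → ℝ) (Cw δw : ℝ) : Prop :=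
  ∀ Q : Set (Rn n), IsDyadicSub a l Q → ∀ E : Set (Rn n), MeasurableSet E → E ⊆ Q →
    wMass w E ≤ ENNReal.ofReal Cw * (volume E / volume Q) ^ δw * wMass w Q

/-- The dyadic sharp maximal function
`M^{d,♯}_{Q₀} f(x) = sup_{Q ∋ x, Q ∈ D(Q₀)} ⨍_Q |f − f_Q|`, where `Q₀ = Cube a l`. -/
def MaxSharp {n : ℕ} (a : Rn n) (l : ℝ) (f : Rn n → ℝ) (x : Rn n) : ℝ≥0∞ :=
  ⨆ (Q : Set (Rn n)) (_ : IsDyadicSub a l Q) (_ : x ∈ Q),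
    ENNReal.ofReal (⨍ y in Q, |f y - ⨍ z in Q, f z|)

theorem two_mul_add_rpow_le {p : ℝ} (hp : 1 ≤ p) (t u : ℝ≥0∞) :
    2 * (t + u) ^ p ≤ 2 ^ p * t ^ p + 2 ^ p * u ^ p := by
  have h := ENNReal.rpow_add_le_mul_rpow_add_rpow t u hp
  calc 2 * (t + u) ^ p ≤ 2 * (2 ^ (p - 1) * (t ^ p + u ^ p)) := by gcongr
    _ = 2 ^ p * (t ^ p + u ^ p) := by
      rw [← mul_assoc]
      congr 1
      nth_rw 1 [← ENNReal.rpow_one 2]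
      rw [← ENNReal.rpow_add _ _ (by simp) (by simp)]
      congr 1
      ring
    _ = _ := by ring

section LevelCell

variable {X I : Type*}

/-- The cell of the partition into level sets of `φ k` containing `x`. -/
def levelCell (φ : ℕ → X → I) (k : ℕ) (x : X) : Set X := {y | φ k y = φ k x}

theorem mem_levelCell_self (φ : ℕ → X → I) (k : ℕ) (x : X) : x ∈ levelCell φ k x := rfl

theorem levelCell_congr {φ : ℕ → X → I} {k : ℕ} {x y : X} (h : φ k x = φ k y) :
    levelCell φ k x = levelCell φ k y := by
  simp only [levelCell, h]

theorem eq_of_level_le {φ : ℕ → X → I}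
    (hnest : ∀ k x y, φ (k + 1) x = φ (k + 1) y → φ k x = φ k y)
    {j k : ℕ} (hjk : j ≤ k) {x y : X} (h : φ k x = φ k y) : φ j x = φ j y := by
  induction k, hjk using Nat.le_induction with
  | base => exact h
  | succ k _ ih => exact ih (hnest _ _ _ h)

variable [MeasurableSpace X]

/-- The mean distance of `f` to the constant `c` over the `k`-th cell of `x`. -/
def cellDist (μ : Measure X) (φ : ℕ → X → I) (f : X → ℝ) (k : ℕ) (x : X) (c : ℝ) : ℝ≥0∞ :=
  (∫⁻ y in levelCell φ k x, ‖f y - c‖ₑ ∂μ) / μ (levelCell φ k x)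

/-- The mean of `f` over the `k`-th cell of `x`. -/
def cellMean (μ : Measure X) (φ : ℕ → X → I) (f : X → ℝ) (k : ℕ) (x : X) : ℝ :=
  ⨍ y in levelCell φ k x, f y ∂μ

variable {φ : ℕ → X → I} {μ ν : Measure X} {f : X → ℝ}

theorem cellDist_congr {k : ℕ} {x y : X} (h : φ k x = φ k y) (c : ℝ) :
    cellDist μ φ f k x c = cellDist μ φ f k y c := by
  simp only [cellDist, levelCell_congr h]

theorem cellMean_congr {k : ℕ} {x y : X} (h : φ k x = φ k y) :
    cellMean μ φ f k x = cellMean μ φ f k y := by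
  simp only [cellMean, levelCell_congr h]

theorem enorm_cellMean_sub_le (hf : Integrable f μ) (h0 : ∀ k x, μ (levelCell φ k x) ≠ 0)
    (htop : ∀ k x, μ (levelCell φ k x) ≠ ∞) (k : ℕ) (x : X) (c : ℝ) :
    ‖cellMean μ φ f k x - c‖ₑ ≤ cellDist μ φ f k x c := by
  set Q := levelCell φ k x
  have : IsFiniteMeasure (μ.restrict Q) := ⟨by simpa using (htop k x).lt_top⟩
  have hc : cellMean μ φ f k x - c = (μ.real Q)⁻¹ • ∫ y in Q, (f y - c) ∂μ := by
    have hne : μ.real Q ≠ 0 := (ENNReal.toReal_pos (h0 k x) (htop k x)).ne'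
    rw [integral_sub hf.integrableOn (integrable_const c), cellMean, setAverage_eq]
    simp only [integral_const, smul_eq_mul, measureReal_restrict_apply_univ]
    change (μ.real Q)⁻¹ * (∫ y in Q, f y ∂μ) - c = _
    field_simp
  rw [hc, enorm_smul, cellDist, ENNReal.div_eq_inv_mul]
  gcongr
  · rw [Real.enorm_eq_ofReal (by positivity), Measure.real,
      ENNReal.ofReal_inv_of_pos (ENNReal.toReal_pos (h0 k x) (htop k x)),
      ENNReal.ofReal_toReal (htop k x)]
  · exact enorm_integral_le_lintegral_enorm _

theorem cellDist_succ_le (hnest : ∀ k x y, φ (k + 1) x = φ (k + 1) y → φ k x = φ k y)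
    {D : ℝ≥0∞} (h0 : ∀ k x, μ (levelCell φ k x) ≠ 0) (htop : ∀ k x, μ (levelCell φ k x) ≠ ∞)
    (hD : ∀ k x, μ (levelCell φ k x) ≤ D * μ (levelCell φ (k + 1) x)) (k : ℕ) (x : X) (c : ℝ) :
    cellDist μ φ f (k + 1) x c ≤ D * cellDist μ φ f k x c := by
  unfold cellDist
  rw [ENNReal.div_le_iff (h0 _ _) (htop _ _)]
  calc ∫⁻ y in levelCell φ (k + 1) x, ‖f y - c‖ₑ ∂μ
      ≤ ∫⁻ y in levelCell φ k x, ‖f y - c‖ₑ ∂μ :=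
        lintegral_mono_set fun y hy => hnest _ _ _ hy
    _ = (∫⁻ y in levelCell φ k x, ‖f y - c‖ₑ ∂μ) / μ (levelCell φ k x)
          * μ (levelCell φ k x) := (ENNReal.div_mul_cancel (h0 _ _) (htop _ _)).symm
    _ ≤ (∫⁻ y in levelCell φ k x, ‖f y - c‖ₑ ∂μ) / μ (levelCell φ k x)
          * (D * μ (levelCell φ (k + 1) x)) := by gcongr; exact hD k x
    _ = _ := by ring

/-- The points of the `k`-th cell of `x₀` for which `j > k` is the first level at which the mean
distance of `f` to `c` exceeds `s`. -/
def firstExceed (μ : Measure X) (φ : ℕ → X → I) (f : X → ℝ) (k : ℕ) (x₀ : X) (c : ℝ) (s : ℝ≥0∞)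
    (j : ℕ) : Set X :=
  {x | x ∈ levelCell φ k x₀ ∧ k < j ∧ s < cellDist μ φ f j x c ∧
    ∀ i, k < i → i < j → cellDist μ φ f i x c ≤ s}

theorem levelCell_subset_firstExceed
    (hnest : ∀ k x y, φ (k + 1) x = φ (k + 1) y → φ k x = φ k y)
    {k j : ℕ} {x₀ x : X} {c : ℝ} {s : ℝ≥0∞} (hx : x ∈ firstExceed μ φ f k x₀ c s j) :
    levelCell φ j x ⊆ firstExceed μ φ f k x₀ c s j := by
  intro y hy
  obtain ⟨h1, h2, h3, h4⟩ := hx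
  refine ⟨(eq_of_level_le hnest h2.le hy).trans h1, h2, ?_, fun i hki hij => ?_⟩
  · rwa [cellDist_congr hy]
  · rw [cellDist_congr (eq_of_level_le hnest hij.le hy)]
    exact h4 i hki hij

theorem pairwise_disjoint_firstExceed (k : ℕ) (x₀ : X) (c : ℝ) (s : ℝ≥0∞) :
    Pairwise (Function.onFun Disjoint (firstExceed μ φ f k x₀ c s)) := by
  refine fun i j hij => Set.disjoint_left.2 fun x hi hj => ?_
  rcases hij.lt_or_gt with h | h
  · exact (hj.2.2.2 i hi.2.1 h).not_gt hi.2.2.1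
  · exact (hi.2.2.2 j hj.2.1 h).not_gt hj.2.2.1

variable [MeasurableSpace I] [MeasurableSingletonClass I]

theorem measurableSet_levelCell (hφ : ∀ k, Measurable (φ k)) (k : ℕ) (x : X) :
    MeasurableSet (levelCell φ k x) :=
  hφ k (measurableSet_singleton (φ k x))

variable [Countable I]

theorem measurable_of_eq_on_levelCell {β : Type*} [MeasurableSpace β] (hφ : ∀ k, Measurable (φ k))
    {k : ℕ} {g : X → β} (hg : ∀ x y, φ k x = φ k y → g x = g y) : Measurable g := by
  intro s _
  have : g ⁻¹' s = φ k ⁻¹' (φ k '' (g ⁻¹' s)) := by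
    ext x
    constructor
    · exact fun h => ⟨x, h, rfl⟩
    · rintro ⟨y, hy, hyx⟩
      have : g x = g y := hg x y hyx.symm
      simpa [this] using hy
  rw [this]
  exact hφ k (Set.to_countable _).measurableSet

/-- Integral inequalities on the cells of a union of cells can be summed. -/
theorem setLIntegral_le_of_levelCell (hφ : ∀ k, Measurable (φ k)) {j : ℕ} {S : Set X}
    (hS : ∀ x ∈ S, levelCell φ j x ⊆ S) {μ₁ μ₂ : Measure X} {F G : X → ℝ≥0∞}
    (h : ∀ x ∈ S, ∫⁻ y in levelCell φ j x, F y ∂μ₁ ≤ ∫⁻ y in levelCell φ j x, G y ∂μ₂) :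
    ∫⁻ y in S, F y ∂μ₁ ≤ ∫⁻ y in S, G y ∂μ₂ := by
  have hcell : ∀ x ∈ S, S ∩ φ j ⁻¹' {φ j x} = levelCell φ j x := fun x hx =>
    Set.inter_eq_right.2 (hS x hx)
  have hU : S = ⋃ i, S ∩ φ j ⁻¹' {i} := by ext x; simp
  have hcase : ∀ i, S ∩ φ j ⁻¹' {i} = ∅ ∨ ∃ x ∈ S, S ∩ φ j ⁻¹' {i} = levelCell φ j x := by
    intro i
    rcases Set.eq_empty_or_nonempty (S ∩ φ j ⁻¹' {i}) with he | ⟨x, hx, hxi⟩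
    · exact Or.inl he
    · obtain rfl : φ j x = i := hxi
      exact Or.inr ⟨x, hx, hcell x hx⟩
  have hmeas : ∀ i, MeasurableSet (S ∩ φ j ⁻¹' {i}) := by
    intro i
    rcases hcase i with he | ⟨x, _, he⟩ <;> rw [he]
    · exact MeasurableSet.empty
    · exact measurableSet_levelCell hφ j x
  have hdisj : Pairwise (Function.onFun Disjoint fun i => S ∩ φ j ⁻¹' {i}) := by
    intro i i' hii'
    refine Set.disjoint_left.2 ?_
    rintro x ⟨_, rfl⟩ ⟨_, hx⟩
    exact hii' hx
  rw [hU, lintegral_iUnion hmeas hdisj, lintegral_iUnion hmeas hdisj]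
  refine ENNReal.tsum_le_tsum fun i => ?_
  rcases hcase i with he | ⟨x, hx, he⟩ <;> rw [he]
  · simp
  · exact h x hx

theorem measurableSet_firstExceed (hφ : ∀ k, Measurable (φ k))
    (hnest : ∀ k x y, φ (k + 1) x = φ (k + 1) y → φ k x = φ k y)
    (k : ℕ) (x₀ : X) (c : ℝ) (s : ℝ≥0∞) (j : ℕ) :
    MeasurableSet (firstExceed μ φ f k x₀ c s j) := by
  have h : Measurable fun x => x ∈ firstExceed μ φ f k x₀ c s j := by
    refine measurable_of_eq_on_levelCell (k := j) hφ fun x y hxy =>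
      propext ⟨fun h => ?_, fun h => ?_⟩
    · exact levelCell_subset_firstExceed hnest h hxy.symm
    · exact levelCell_subset_firstExceed hnest h hxy
  simpa using measurableSet_setOfPred.2 h

/-- The weak type bound for the stopping set. -/
theorem mul_measure_iUnion_firstExceed_le (hφ : ∀ k, Measurable (φ k))
    (hnest : ∀ k x y, φ (k + 1) x = φ (k + 1) y → φ k x = φ k y) (hf : Integrable f μ)
    (h0 : ∀ k x, μ (levelCell φ k x) ≠ 0) (htop : ∀ k x, μ (levelCell φ k x) ≠ ∞)
    (r : ℝ≥0∞) (k : ℕ) (x₀ : X) (c : ℝ) (J : Set ℕ) :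
    r * μ (⋃ j ∈ J, firstExceed μ φ f k x₀ c (r * cellDist μ φ f k x₀ c) j)
      ≤ μ (levelCell φ k x₀) := by
  set Q := levelCell φ k x₀
  set o := cellDist μ φ f k x₀ c
  set S := firstExceed μ φ f k x₀ c (r * o)
  have hSQ : ∀ j, S j ⊆ Q := fun j x hx => hx.1
  have hoQ : o * μ Q = ∫⁻ y in Q, ‖f y - c‖ₑ ∂μ := ENNReal.div_mul_cancel (h0 _ _) (htop _ _)
  have hfin : ∫⁻ y in Q, ‖f y - c‖ₑ ∂μ ≠ ∞ := by
    have : IsFiniteMeasure (μ.restrict Q) := ⟨by simpa using (htop k x₀).lt_top⟩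
    exact (hf.integrableOn.sub (integrable_const c)).2.ne
  have ho_top : o ≠ ∞ := fun h => by
    rw [h, ENNReal.top_mul (h0 k x₀)] at hoQ
    exact hfin hoQ.symm
  by_cases ho0 : o = 0
  · have hSe : ∀ j, S j = ∅ := by
      refine fun j => Set.eq_empty_of_forall_notMem fun x hx => ?_
      have h1 : 0 < cellDist μ φ f j x c := lt_of_le_of_lt zero_le hx.2.2.1
      refine h1.ne' ?_
      rw [cellDist, ENNReal.div_eq_zero_iff]
      left
      refine le_antisymm ?_ zero_le
      calc _ ≤ ∫⁻ y in Q, ‖f y - c‖ₑ ∂μ :=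
            lintegral_mono_set ((levelCell_subset_firstExceed hnest hx).trans (hSQ j))
        _ = 0 := by rw [← hoQ, ho0, zero_mul]
    simp [hSe]
  · have hmeas : ∀ j, MeasurableSet (S j) := measurableSet_firstExceed hφ hnest _ _ _ _
    have hdisj := pairwise_disjoint_firstExceed (μ := μ) (φ := φ) (f := f) k x₀ c (r * o)
    have hj : ∀ j, r * o * μ (S j) ≤ ∫⁻ y in S j, ‖f y - c‖ₑ ∂μ := by
      intro j
      rw [← setLIntegral_const]
      refine setLIntegral_le_of_levelCell hφ (j := j)
        (fun x hx => levelCell_subset_firstExceed hnest hx) fun x hx => ?_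
      rw [setLIntegral_const, ← ENNReal.le_div_iff_mul_le (Or.inl (h0 _ _)) (Or.inl (htop _ _))]
      exact hx.2.2.1.le
    have hall : r * o * μ (⋃ j ∈ J, S j) ≤ o * μ Q := by
      rw [hoQ, measure_biUnion J.to_countable (fun i _ j _ h => hdisj h) fun j _ => hmeas j,
        ← ENNReal.tsum_mul_left]
      refine (ENNReal.tsum_le_tsum fun j : J => hj j).trans ?_
      rw [← lintegral_biUnion J.to_countable (fun j _ => hmeas j) (fun i _ j _ h => hdisj h)]
      exact lintegral_mono_set (Set.iUnion₂_subset fun j _ => hSQ j)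
    rw [mul_comm r o, mul_assoc] at hall
    exact (ENNReal.mul_le_mul_iff_right ho0 ho_top).1 hall

/-- Good-λ type induction over the levels: the means of `f` at level `K` are controlled by any
majorant `M` of the mean oscillations over cells. -/
theorem lintegral_cellMean_sub_add_rpow_le {p : ℝ} (hp : 1 ≤ p) {r D : ℝ≥0∞} (hr : 1 ≤ r)
    (hD1 : 1 ≤ D) (hφ : ∀ k, Measurable (φ k))
    (hnest : ∀ k x y, φ (k + 1) x = φ (k + 1) y → φ k x = φ k y) (hf : Integrable f μ)
    (h0 : ∀ k x, μ (levelCell φ k x) ≠ 0) (htop : ∀ k x, μ (levelCell φ k x) ≠ ∞)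
    (hD : ∀ k x, μ (levelCell φ k x) ≤ D * μ (levelCell φ (k + 1) x))
    [IsFiniteMeasure ν] {Q₀ : Set X}
    (hν : ∀ k, ∀ x ∈ Q₀, ∀ E ⊆ levelCell φ k x, MeasurableSet E →
      r * μ E ≤ μ (levelCell φ k x) → 2 ^ p * ν E ≤ ν (levelCell φ k x))
    {M : X → ℝ≥0∞} (hM : ∀ k, ∀ x ∈ Q₀, cellDist μ φ f k x (cellMean μ φ f k x) ≤ M x)
    (K d k : ℕ) (hK : k + d = K) (x₀ : X) (hx₀ : levelCell φ k x₀ ⊆ Q₀)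
    (t : ℝ≥0∞) :
    ∫⁻ x in levelCell φ k x₀, (‖cellMean μ φ f K x - cellMean μ φ f k x₀‖ₑ + t) ^ p ∂ν ≤
      ∫⁻ x in levelCell φ k x₀, (2 ^ p * t ^ p + 2 * (2 ^ p * (D * r) ^ p) * M x ^ p) ∂ν := by
  induction d using Nat.strong_induction_on generalizing k x₀ t with
  | _ d ih =>
  have hp0 : 0 ≤ p := zero_le_one.trans hp
  set Q := levelCell φ k x₀
  set c := cellMean μ φ f k x₀
  set o := cellDist μ φ f k x₀ c
  set A := D * r
  set C := 2 * (2 ^ p * A ^ p)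
  set S := firstExceed μ φ f k x₀ c (r * o)
  set E := ⋃ j ∈ Set.Ioc k K, S j
  have hrA : r ≤ A := le_mul_of_one_le_left zero_le hD1
  have hSQ : ∀ j, S j ⊆ Q := fun j x hx => hx.1
  have hEQ : E ⊆ Q := Set.iUnion₂_subset fun j _ => hSQ j
  have hQm : MeasurableSet Q := measurableSet_levelCell hφ k x₀
  have hSm : ∀ j, MeasurableSet (S j) := measurableSet_firstExceed hφ hnest _ _ _ _
  have hEm : MeasurableSet E := MeasurableSet.biUnion (Set.to_countable _) fun j _ => hSm j
  have hdisj := pairwise_disjoint_firstExceed (μ := μ) (φ := φ) (f := f) k x₀ c (r * o)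
  have hoM : ∀ x ∈ Q, o ≤ M x := by
    intro x hx
    have h := hM k x (hx₀ hx)
    rwa [cellDist_congr hx, cellMean_congr hx] at h
  have hνE : 2 ^ p * ν E ≤ ν Q :=
    hν k x₀ (hx₀ (mem_levelCell_self φ k x₀)) E hEQ hEm
      (mul_measure_iUnion_firstExceed_le hφ hnest hf h0 htop r k x₀ c _)
  have hstep : ∀ j ∈ Set.Ioc k K, ∀ x ∈ S j, ‖cellMean μ φ f j x - c‖ₑ ≤ A * o := by
    intro j hj x hx
    obtain ⟨i, rfl⟩ : ∃ i, j = i + 1 := ⟨j - 1, by have := hj.1; lia⟩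
    have hi : cellDist μ φ f i x c ≤ r * o := by
      rcases (Nat.lt_succ_iff.1 hj.1).eq_or_lt with rfl | hki
      · rw [cellDist_congr hx.1]
        exact le_mul_of_one_le_left zero_le hr
      · exact hx.2.2.2 i hki i.lt_succ_self
    calc _ ≤ cellDist μ φ f (i + 1) x c := enorm_cellMean_sub_le hf h0 htop _ _ _
      _ ≤ D * cellDist μ φ f i x c := cellDist_succ_le hnest h0 htop hD i x c
      _ ≤ D * (r * o) := by gcongr
      _ = A * o := (mul_assoc _ _ _).symm
  have hSj : ∀ j ∈ Set.Ioc k K, ∫⁻ x in S j, (‖cellMean μ φ f K x - c‖ₑ + t) ^ p ∂ν ≤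
      ∫⁻ x in S j, (2 ^ p * (t + A * o) ^ p + C * M x ^ p) ∂ν := by
    intro j hj
    refine setLIntegral_le_of_levelCell hφ (j := j)
      (fun x hx => levelCell_subset_firstExceed hnest hx) fun x hx => ?_
    obtain ⟨hkj, hjK⟩ := hj
    refine le_trans (lintegral_mono fun y => ?_) (ih (K - j) (by lia) j (by lia) x
      (((levelCell_subset_firstExceed hnest hx).trans (hSQ j)).trans hx₀) (t + A * o))
    refine ENNReal.rpow_le_rpow ?_ hp0
    calc ‖cellMean μ φ f K y - c‖ₑ + t
        = ‖(cellMean μ φ f K y - cellMean μ φ f j x) + (cellMean μ φ f j x - c)‖ₑ + t := by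
          rw [sub_add_sub_cancel]
      _ ≤ ‖cellMean μ φ f K y - cellMean μ φ f j x‖ₑ + ‖cellMean μ φ f j x - c‖ₑ + t := by
          gcongr
          exact enorm_add_le _ _
      _ ≤ ‖cellMean μ φ f K y - cellMean μ φ f j x‖ₑ + A * o + t := by
          gcongr
          exact hstep j ⟨hkj, hjK⟩ x hx
      _ = _ := by ring
  have hE : ∫⁻ x in E, (‖cellMean μ φ f K x - c‖ₑ + t) ^ p ∂ν ≤
      (t + A * o) ^ p * ν Q + ∫⁻ x in E, C * M x ^ p ∂ν := by
    calc _ ≤ ∫⁻ x in E, (2 ^ p * (t + A * o) ^ p + C * M x ^ p) ∂ν := by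
          rw [lintegral_biUnion (Set.to_countable _) (fun j _ => hSm j) (fun i _ j _ h => hdisj h),
            lintegral_biUnion (Set.to_countable _) (fun j _ => hSm j) (fun i _ j _ h => hdisj h)]
          exact ENNReal.tsum_le_tsum fun j => hSj j j.2
      _ = (t + A * o) ^ p * (2 ^ p * ν E) + ∫⁻ x in E, C * M x ^ p ∂ν := by
          rw [lintegral_add_left measurable_const, setLIntegral_const]
          ring
      _ ≤ _ := by gcongr
  have hgood : ∫⁻ x in Q \ E, (‖cellMean μ φ f K x - c‖ₑ + t) ^ p ∂ν ≤
      (t + A * o) ^ p * ν Q := by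
    calc _ ≤ ∫⁻ x in Q \ E, (t + A * o) ^ p ∂ν := by
          refine setLIntegral_mono' (hQm.diff hEm) fun x hx => ENNReal.rpow_le_rpow ?_ hp0
          rw [add_comm]
          gcongr
          refine (enorm_cellMean_sub_le hf h0 htop _ _ _).trans ?_
          by_contra! hlt
          have hrlt : r * o < cellDist μ φ f K x c := lt_of_le_of_lt (by gcongr) hlt
          have hkK : k < K := by
            refine lt_of_le_of_ne (by lia) fun h => ?_
            subst h
            rw [cellDist_congr hx.1] at hrlt
            exact (le_mul_of_one_le_left zero_le hr).not_gt hrlt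
          classical
          have hex : ∃ j, k < j ∧ r * o < cellDist μ φ f j x c := ⟨K, hkK, hrlt⟩
          refine hx.2 (Set.mem_iUnion₂.2 ⟨Nat.find hex,
            ⟨(Nat.find_spec hex).1, Nat.find_min' hex ⟨hkK, hrlt⟩⟩, hx.1, (Nat.find_spec hex).1,
            (Nat.find_spec hex).2, fun i hki hi => ?_⟩)
          by_contra! h
          exact Nat.find_min hex hi ⟨hki, h⟩
      _ = (t + A * o) ^ p * ν (Q \ E) := setLIntegral_const _ _
      _ ≤ _ := by gcongr; exact Set.sdiff_subset
  have hνQ : ν Q ≤ 2 * ν (Q \ E) := by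
    have h2 : 2 * ν E ≤ ν Q := by
      refine le_trans ?_ hνE
      gcongr
      calc (2 : ℝ≥0∞) = 2 ^ (1 : ℝ) := (ENNReal.rpow_one 2).symm
        _ ≤ 2 ^ p := ENNReal.rpow_le_rpow_of_exponent_le (by norm_num) hp
    have hadd : ν E + ν (Q \ E) = ν Q := by
      rw [← measure_inter_add_sdiff Q hEm, Set.inter_eq_right.2 hEQ]
    have hfin : ν Q ≠ ∞ := measure_ne_top _ _
    refine (ENNReal.add_le_add_iff_left hfin).1 ?_
    calc ν Q + ν Q = 2 * ν E + 2 * ν (Q \ E) := by rw [← mul_add, hadd, two_mul]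
      _ ≤ ν Q + 2 * ν (Q \ E) := by gcongr
  have hosc : 2 ^ p * (A * o) ^ p * ν Q ≤ ∫⁻ x in Q \ E, C * M x ^ p ∂ν := by
    calc 2 ^ p * (A * o) ^ p * ν Q ≤ 2 ^ p * (A * o) ^ p * (2 * ν (Q \ E)) := by gcongr
      _ = ∫⁻ x in Q \ E, C * o ^ p ∂ν := by
          rw [setLIntegral_const, ENNReal.mul_rpow_of_nonneg _ _ hp0]
          ring
      _ ≤ _ := by
          refine setLIntegral_mono' (hQm.diff hEm) fun x hx => ?_
          gcongr
          exact hoM x hx.1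
  have hsplit : ∀ F : X → ℝ≥0∞,
      ∫⁻ x in Q, F x ∂ν = ∫⁻ x in E, F x ∂ν + ∫⁻ x in Q \ E, F x ∂ν := by
    intro F
    rw [← lintegral_inter_add_sdiff F Q hEm, Set.inter_eq_right.2 hEQ]
  calc _ ≤ ((t + A * o) ^ p * ν Q + ∫⁻ x in E, C * M x ^ p ∂ν) + (t + A * o) ^ p * ν Q := by
        rw [hsplit]
        exact add_le_add hE hgood
    _ = 2 * (t + A * o) ^ p * ν Q + ∫⁻ x in E, C * M x ^ p ∂ν := by ring
    _ ≤ (2 ^ p * t ^ p + 2 ^ p * (A * o) ^ p) * ν Q + ∫⁻ x in E, C * M x ^ p ∂ν := by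
        gcongr
        exact two_mul_add_rpow_le hp _ _
    _ = 2 ^ p * t ^ p * ν Q + (∫⁻ x in E, C * M x ^ p ∂ν + 2 ^ p * (A * o) ^ p * ν Q) := by ring
    _ ≤ 2 ^ p * t ^ p * ν Q + (∫⁻ x in E, C * M x ^ p ∂ν + ∫⁻ x in Q \ E, C * M x ^ p ∂ν) := by
        gcongr
    _ = _ := by
        rw [← hsplit, lintegral_add_left measurable_const, setLIntegral_const]

end LevelCell

section Dyadic

open Filter Topology

variable {n : ℕ}

/-- The integer coordinates of the dyadic cube of generation `k` containing `x`, in the grid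
spanned by the cube with corner `a` and side length `l`. -/
def dyadicIndex (a : Rn n) (l : ℝ) (k : ℕ) (x : Rn n) : Fin n → ℤ :=
  fun i => ⌊2 ^ k * ((x i - a i) / l)⌋

/-- The lower corner of the dyadic cube of generation `k` containing `x`. -/
def dyadicCorner (a : Rn n) (l : ℝ) (k : ℕ) (x : Rn n) : Fin n → ℝ :=
  fun i => a i + l * dyadicIndex a l k x i / 2 ^ k

variable {a : Rn n} {l : ℝ}

theorem measurable_dyadicIndex (a : Rn n) (l : ℝ) (k : ℕ) : Measurable (dyadicIndex a l k) := by
  refine measurable_pi_lambda _ fun i => ?_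
  have : Measurable fun x : Rn n => x i := by fun_prop
  exact Int.measurable_floor.comp (by fun_prop)

theorem dyadicIndex_nested (a : Rn n) (l : ℝ) (k : ℕ) (x y : Rn n)
    (h : dyadicIndex a l (k + 1) x = dyadicIndex a l (k + 1) y) :
    dyadicIndex a l k x = dyadicIndex a l k y := by
  have key : ∀ z i, dyadicIndex a l k z i = dyadicIndex a l (k + 1) z i / 2 := by
    intro z i
    have := Int.natCast_mul_floor_div_cancel (n := 2) two_ne_zero (2 ^ k * ((z i - a i) / l))
    simp only [dyadicIndex]
    rw [← this, pow_succ]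
    push_cast
    congr 2
    ring
  funext i
  rw [key, key, h]

theorem dyadicIndex_apply_eq_iff (hl : 0 < l) {k : ℕ} {y : Rn n} {i : Fin n} {m : ℤ} :
    dyadicIndex a l k y i = m ↔
      a i + l * m / 2 ^ k ≤ y i ∧ y i < a i + l * m / 2 ^ k + l / 2 ^ k := by
  have h2 : (0 : ℝ) < 2 ^ k := by positivity
  have e : 2 ^ k * ((y i - a i) / l) = (y i - a i) / (l / 2 ^ k) := by field_simp
  have hq : 0 < l / 2 ^ k := by positivity
  rw [dyadicIndex, Int.floor_eq_iff, e, le_div_iff₀ hq, div_lt_iff₀ hq]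
  have e1 : (m : ℝ) * (l / 2 ^ k) = l * m / 2 ^ k := by ring
  have e2 : ((m : ℝ) + 1) * (l / 2 ^ k) = l * m / 2 ^ k + l / 2 ^ k := by ring
  rw [e1, e2]
  constructor <;> rintro ⟨h, h'⟩ <;> constructor <;> linarith

theorem levelCell_dyadicIndex_eq_setOf (hl : 0 < l) (k : ℕ) (x : Rn n) :
    levelCell (dyadicIndex a l) k x =
      {y | ∀ i, dyadicCorner a l k x i ≤ y i ∧ y i < dyadicCorner a l k x i + l / 2 ^ k} := by
  ext y
  simp only [levelCell, Set.mem_ofPred_eq, funext_iff, dyadicCorner, dyadicIndex_apply_eq_iff hl]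

theorem levelCell_dyadicIndex_eq_preimage (hl : 0 < l) (k : ℕ) (x : Rn n) :
    levelCell (dyadicIndex a l) k x = WithLp.ofLp ⁻¹'
      Set.univ.pi fun i => Set.Ico (dyadicCorner a l k x i)
        (dyadicCorner a l k x i + l / 2 ^ k) := by
  rw [levelCell_dyadicIndex_eq_setOf hl]
  ext y
  simp

theorem volume_levelCell_dyadicIndex (hl : 0 < l) (k : ℕ) (x : Rn n) :
    volume (levelCell (dyadicIndex a l) k x) = ENNReal.ofReal (l / 2 ^ k) ^ n := by
  rw [levelCell_dyadicIndex_eq_preimage hl,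
    (PiLp.volume_preserving_ofLp (Fin n)).measure_preimage
      (MeasurableSet.univ_pi fun _ => measurableSet_Ico).nullMeasurableSet, Real.volume_pi_Ico]
  simp

theorem levelCell_dyadicIndex_zero (hl : 0 < l) {x : Rn n} (hx : x ∈ Cube a l) :
    levelCell (dyadicIndex a l) 0 x = Cube a l := by
  have h0 : ∀ i, dyadicIndex a l 0 x i = 0 := fun i =>
    (dyadicIndex_apply_eq_iff hl).2 (by simpa using hx i)
  rw [levelCell_dyadicIndex_eq_setOf hl]
  simp [dyadicCorner, h0, Cube]

theorem isDyadicSub_levelCell (hl : 0 < l) (k : ℕ) {x : Rn n} (hx : x ∈ Cube a l) :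
    IsDyadicSub a l (levelCell (dyadicIndex a l) k x) := by
  have hpos : ∀ i, 0 ≤ dyadicIndex a l k x i := fun i =>
    Int.floor_nonneg.2 (mul_nonneg (by positivity) (div_nonneg (by linarith [(hx i).1]) hl.le))
  refine ⟨k, fun i => (dyadicIndex a l k x i).toNat, fun i => ?_, ?_⟩
  · rw [Int.toNat_lt (hpos i), dyadicIndex, Int.floor_lt]
    push_cast
    have : (x i - a i) / l < 1 := by
      rw [div_lt_one hl]
      linarith [(hx i).2]
    exact mul_lt_of_lt_one_right (by positivity) this
  · have hc : ∀ i, (((dyadicIndex a l k x i).toNat : ℕ) : ℝ) = dyadicIndex a l k x i := fun i => by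
      exact_mod_cast congrArg (Int.cast (R := ℝ)) (Int.toNat_of_nonneg (hpos i))
    simp only [hc]
    exact levelCell_dyadicIndex_eq_setOf hl k x

theorem levelCell_dyadicIndex_subset (hl : 0 < l) (k : ℕ) {x : Rn n} (hx : x ∈ Cube a l) :
    levelCell (dyadicIndex a l) k x ⊆ Cube a l := by
  rw [← levelCell_dyadicIndex_zero hl hx]
  exact fun y hy => eq_of_level_le (dyadicIndex_nested a l) (Nat.zero_le k) hy

/-- Lebesgue differentiation along dyadic cubes. -/
theorem ae_tendsto_cellMean_dyadicIndex (hl : 0 < l) {f : Rn n → ℝ} (hf : Integrable f) :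
    ∀ᵐ x, Tendsto (fun k => cellMean volume (dyadicIndex a l) f k x) atTop (𝓝 (f x)) := by
  have hmp := PiLp.volume_preserving_ofLp (Fin n)
  have hemb : MeasurableEmbedding (WithLp.ofLp : Rn n → Fin n → ℝ) :=
    (MeasurableEquiv.toLp 2 (Fin n → ℝ)).symm.measurableEmbedding
  set g : (Fin n → ℝ) → ℝ := fun z => f (WithLp.toLp 2 z)
  have hg : Integrable g :=
    (PiLp.volume_preserving_toLp (Fin n)).integrable_comp_of_integrable hf
  have hleb := IsUnifLocDoublingMeasure.ae_tendsto_average (μ := (volume : Measure (Fin n → ℝ)))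
    hg.locallyIntegrable 1
  filter_upwards [hmp.quasiMeasurePreserving.ae hleb] with x hx
  set δ : ℕ → ℝ := fun k => l / 2 ^ k / 2
  have hδ0 : ∀ k, 0 < δ k := fun k => by positivity
  have hδ : Tendsto δ atTop (𝓝[>] 0) := by
    refine tendsto_nhdsWithin_iff.2 ⟨?_, Eventually.of_forall hδ0⟩
    have h := (tendsto_pow_atTop_nhds_zero_of_lt_one (r := (1 / 2 : ℝ)) (by norm_num)
      (by norm_num)).const_mul (l / 2)
    rw [mul_zero] at h
    refine h.congr fun k => ?_
    simp only [δ, one_div, inv_pow]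
    ring
  have hball : ∀ k, Metric.closedBall (fun i => dyadicCorner a l k x i + δ k) (δ k) =
      Set.Icc (dyadicCorner a l k x) (fun i => dyadicCorner a l k x i + l / 2 ^ k) := by
    intro k
    rw [closedBall_pi _ (hδ0 k).le, ← Set.pi_univ_Icc]
    congr 1
    funext i
    rw [Real.closedBall_eq_Icc]
    congr 1 <;> simp only [δ] <;> ring
  have hxmem : ∀ k, WithLp.ofLp x ∈
      Metric.closedBall (fun i => dyadicCorner a l k x i + δ k) (1 * δ k) := by
    intro k
    have h := mem_levelCell_self (dyadicIndex a l) k x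
    rw [levelCell_dyadicIndex_eq_setOf hl] at h
    rw [one_mul, hball]
    exact ⟨fun i => (h i).1, fun i => (h i).2.le⟩
  refine (hx _ δ hδ (Eventually.of_forall hxmem)).congr fun k => ?_
  have hae : (Set.univ.pi fun i => Set.Ico (dyadicCorner a l k x i)
      (dyadicCorner a l k x i + l / 2 ^ k)) =ᵐ[volume]
      Set.Icc (dyadicCorner a l k x) (fun i => dyadicCorner a l k x i + l / 2 ^ k) :=
    Measure.univ_pi_Ico_ae_eq_Icc
  rw [hball, cellMean, ← setAverage_congr hae, setAverage_eq, setAverage_eq,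
    levelCell_dyadicIndex_eq_preimage hl, Measure.real, Measure.real,
    hmp.measure_preimage (MeasurableSet.univ_pi fun _ => measurableSet_Ico).nullMeasurableSet,
    ← hmp.setIntegral_preimage_emb hemb]

theorem measurableSet_cube (hl : 0 < l) : MeasurableSet (Cube a l) := by
  rw [← levelCell_dyadicIndex_zero (x := a) hl fun i => ⟨le_rfl, by linarith⟩]
  exact measurableSet_levelCell (measurable_dyadicIndex a l) 0 a

theorem cellDist_cellMean_le_maxSharp (hl : 0 < l) {f : Rn n → ℝ}
    (hf : IntegrableOn f (Cube a l)) (k : ℕ) {x : Rn n} (hx : x ∈ Cube a l) :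
    cellDist volume (dyadicIndex a l) ((Cube a l).indicator f) k x
      (cellMean volume (dyadicIndex a l) ((Cube a l).indicator f) k x) ≤ MaxSharp a l f x := by
  set Q := levelCell (dyadicIndex a l) k x
  have hQ : Q ⊆ Cube a l := levelCell_dyadicIndex_subset hl k hx
  have hQm : MeasurableSet Q := measurableSet_levelCell (measurable_dyadicIndex a l) k x
  have htop : volume Q ≠ ∞ := by
    rw [volume_levelCell_dyadicIndex hl]
    finiteness
  have hmean : cellMean volume (dyadicIndex a l) ((Cube a l).indicator f) k x = ⨍ z in Q, f z :=
    setAverage_congr_fun hQm (Eventually.of_forall fun y hy => Set.indicator_of_mem (hQ hy) f)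
  refine le_trans (le_of_eq ?_) (le_iSup₂_of_le Q (isDyadicSub_levelCell hl k hx)
    (le_iSup_of_le (mem_levelCell_self (dyadicIndex a l) k x) le_rfl))
  have hint : IntegrableOn (fun y => |f y - ⨍ z in Q, f z|) Q :=
    ((hf.mono_set hQ).sub (integrableOn_const htop)).abs
  rw [hmean, cellDist, ofReal_setAverage hint (Eventually.of_forall fun y => abs_nonneg _)]
  congr 1
  refine setLIntegral_congr_fun hQm fun y hy => ?_
  simp only [Set.indicator_of_mem (hQ hy), Real.enorm_eq_ofReal_abs]

theorem wMass_le_of_isAinftyD {w : Rn n → ℝ} {Cw δw p : ℝ} {r : ℝ≥0∞} (hδw : 0 < δw)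
    (hw : IsAinftyD a l w Cw δw) (hr0 : r ≠ 0) (hrtop : r ≠ ∞)
    (hr : 2 ^ p * ENNReal.ofReal Cw ≤ r ^ δw)
    {Q E : Set (Rn n)} (hQ : IsDyadicSub a l Q) (hE : MeasurableSet E) (hEQ : E ⊆ Q)
    (hsmall : r * volume E ≤ volume Q) (hQ0 : volume Q ≠ 0) (hQtop : volume Q ≠ ∞) :
    2 ^ p * wMass w E ≤ wMass w Q := by
  have hratio : volume E / volume Q ≤ r⁻¹ := by
    rw [ENNReal.div_le_iff hQ0 hQtop, ← ENNReal.div_eq_inv_mul,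
      ENNReal.le_div_iff_mul_le (Or.inl hr0) (Or.inl hrtop), mul_comm]
    exact hsmall
  have hrδ0 : r ^ δw ≠ 0 := (ENNReal.rpow_pos (pos_iff_ne_zero.2 hr0) hrtop).ne'
  have hrδtop : r ^ δw ≠ ∞ := ENNReal.rpow_ne_top_of_nonneg hδw.le hrtop
  calc 2 ^ p * wMass w E
      ≤ 2 ^ p * (ENNReal.ofReal Cw * (volume E / volume Q) ^ δw * wMass w Q) := by
        gcongr
        exact hw Q hQ E hE hEQ
    _ ≤ 2 ^ p * (ENNReal.ofReal Cw * r⁻¹ ^ δw * wMass w Q) := by gcongr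
    _ = (2 ^ p * ENNReal.ofReal Cw) * (r ^ δw)⁻¹ * wMass w Q := by
        rw [ENNReal.inv_rpow]
        ring
    _ ≤ r ^ δw * (r ^ δw)⁻¹ * wMass w Q := by gcongr
    _ = wMass w Q := by rw [ENNReal.mul_inv_cancel hrδ0 hrδtop, one_mul]

theorem lintegral_enorm_sub_average_rpow_le {p Cw δw : ℝ} {r : ℝ≥0∞} (hp : 1 ≤ p) (hδw : 0 < δw)
    (hr1 : 1 ≤ r) (hrtop : r ≠ ∞) (hr : 2 ^ p * ENNReal.ofReal Cw ≤ r ^ δw) (hl : 0 < l)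
    {w : Rn n → ℝ} (hwint : IntegrableOn w (Cube a l)) (hw : IsAinftyD a l w Cw δw)
    {f : Rn n → ℝ} (hf : IntegrableOn f (Cube a l)) :
    ∫⁻ x in Cube a l, (ENNReal.ofReal |f x - ⨍ y in Cube a l, f y|) ^ p * ENNReal.ofReal (w x) ≤
      2 * (2 ^ p * (2 ^ n * r) ^ p) *
        ∫⁻ x in Cube a l, MaxSharp a l f x ^ p * ENNReal.ofReal (w x) := by
  have hp0 : 0 ≤ p := zero_le_one.trans hp
  set Q₀ := Cube a l
  set φ := dyadicIndex a l
  set g : Rn n → ℝ := Q₀.indicator f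
  set W : Rn n → ℝ≥0∞ := fun x => ENNReal.ofReal (w x)
  set ν : Measure (Rn n) := (volume.restrict Q₀).withDensity W
  set M : Rn n → ℝ≥0∞ := fun x => ⨆ k, cellDist volume φ g k x (cellMean volume φ g k x)
  have hQ₀m : MeasurableSet Q₀ := measurableSet_cube hl
  have hφ : ∀ k, Measurable (φ k) := measurable_dyadicIndex a l
  have hWm : AEMeasurable W (volume.restrict Q₀) := hwint.aemeasurable.ennreal_ofReal
  have hg : Integrable g := (integrable_indicator_iff hQ₀m).2 hf
  have ha : a ∈ Q₀ := fun i => ⟨le_rfl, by linarith⟩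
  have hcell : levelCell φ 0 a = Q₀ := levelCell_dyadicIndex_zero hl ha
  have hvol0 : ∀ k x, volume (levelCell φ k x) ≠ 0 := fun k x => by
    rw [volume_levelCell_dyadicIndex hl]
    exact pow_ne_zero _ (ENNReal.ofReal_pos.2 (by positivity)).ne'
  have hvoltop : ∀ k x, volume (levelCell φ k x) ≠ ∞ := fun k x => by
    rw [volume_levelCell_dyadicIndex hl]
    finiteness
  have hvolD : ∀ k x, volume (levelCell φ k x) ≤ 2 ^ n * volume (levelCell φ (k + 1) x) := by
    intro k x
    rw [volume_levelCell_dyadicIndex hl, volume_levelCell_dyadicIndex hl, ← mul_pow,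
      ← ENNReal.ofReal_ofNat 2, ← ENNReal.ofReal_mul (by norm_num)]
    apply le_of_eq
    congr 2
    rw [pow_succ]
    field_simp
  have hνapply : ∀ E ⊆ Q₀, MeasurableSet E → ν E = wMass w E := by
    intro E hE hEm
    rw [withDensity_apply _ hEm, Measure.restrict_restrict_of_subset hE, wMass]
  have hνfin : IsFiniteMeasure ν := isFiniteMeasure_withDensity_ofReal hwint.2
  have hνrestrict : ν.restrict Q₀ = ν := by
    rw [restrict_withDensity hQ₀m, Measure.restrict_restrict_of_subset subset_rfl]
  have hνsmall : ∀ k, ∀ x ∈ Q₀, ∀ E ⊆ levelCell φ k x, MeasurableSet E →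
      r * volume E ≤ volume (levelCell φ k x) → 2 ^ p * ν E ≤ ν (levelCell φ k x) := by
    intro k x hx E hE hEm hsmall
    have hsub : levelCell φ k x ⊆ Q₀ := levelCell_dyadicIndex_subset hl k hx
    rw [hνapply E (hE.trans hsub) hEm, hνapply _ hsub (measurableSet_levelCell hφ k x)]
    exact wMass_le_of_isAinftyD hδw hw (zero_lt_one.trans_le hr1).ne' hrtop hr
      (isDyadicSub_levelCell hl k hx) hEm hE hsmall (hvol0 k x) (hvoltop k x)
  have hcellMean_meas : ∀ k, Measurable (cellMean volume φ g k) := fun k =>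
    measurable_of_eq_on_levelCell hφ (k := k) fun x y h => cellMean_congr h
  have hMm : Measurable M := Measurable.iSup fun k =>
    measurable_of_eq_on_levelCell hφ (k := k) fun x y h => by
      rw [cellMean_congr h, cellDist_congr h]
  set c := ⨍ y in Q₀, f y
  have hc : cellMean volume φ g 0 a = c := by
    rw [cellMean, hcell]
    exact setAverage_congr_fun hQ₀m (Eventually.of_forall fun y hy => Set.indicator_of_mem hy f)
  have hlevel : ∀ K, ∫⁻ x, ‖cellMean volume φ g K x - c‖ₑ ^ p ∂ν ≤
      2 * (2 ^ p * (2 ^ n * r) ^ p) * ∫⁻ x, M x ^ p ∂ν := by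
    intro K
    have h := lintegral_cellMean_sub_add_rpow_le hp hr1 (one_le_pow₀ one_le_two) hφ
      (dyadicIndex_nested a l) hg hvol0 hvoltop hvolD hνsmall (M := M)
      (fun k x _ => le_iSup (fun k => cellDist volume φ g k x (cellMean volume φ g k x)) k)
      K K 0 (zero_add K) a hcell.subset 0
    rw [hcell, hνrestrict, hc] at h
    simpa [ENNReal.zero_rpow_of_pos (zero_lt_one.trans_le hp),
      lintegral_const_mul _ (hMm.pow_const p)] using h
  have hae : ∀ᵐ x ∂ν, Tendsto (fun K => ‖cellMean volume φ g K x - c‖ₑ ^ p) atTop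
      (𝓝 (‖g x - c‖ₑ ^ p)) := by
    have hac : ν ≪ volume :=
      (withDensity_absolutelyContinuous _ _).trans Measure.restrict_le_self.absolutelyContinuous
    filter_upwards [hac.ae_le (ae_tendsto_cellMean_dyadicIndex hl hg)] with x hx
    exact ((hx.sub_const c).enorm).ennrpow_const p
  have hgm : AEMeasurable (fun x => ‖g x - c‖ₑ ^ p) (volume.restrict Q₀) :=
    ((hg.aemeasurable.restrict.sub_const c).enorm).pow_const p
  calc ∫⁻ x in Q₀, (ENNReal.ofReal |f x - c|) ^ p * W x
      = ∫⁻ x, ‖g x - c‖ₑ ^ p ∂ν := by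
        rw [lintegral_withDensity_eq_lintegral_mul₀ hWm hgm]
        refine setLIntegral_congr_fun hQ₀m fun x hx => ?_
        simp only [Pi.mul_apply, g, Set.indicator_of_mem hx, Real.enorm_eq_ofReal_abs]
        rw [mul_comm]
    _ = ∫⁻ x, liminf (fun K => ‖cellMean volume φ g K x - c‖ₑ ^ p) atTop ∂ν :=
        lintegral_congr_ae (hae.mono fun x hx => hx.liminf_eq.symm)
    _ ≤ liminf (fun K => ∫⁻ x, ‖cellMean volume φ g K x - c‖ₑ ^ p ∂ν) atTop :=
        lintegral_liminf_le fun K => (((hcellMean_meas K).sub_const c).enorm).pow_const p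
    _ ≤ 2 * (2 ^ p * (2 ^ n * r) ^ p) * ∫⁻ x, M x ^ p ∂ν :=
        (liminf_le_liminf (Eventually.of_forall hlevel)).trans (liminf_const _).le
    _ ≤ _ := by
        rw [lintegral_withDensity_eq_lintegral_mul₀ hWm (hMm.pow_const p).aemeasurable]
        gcongr 2 * (2 ^ p * (2 ^ n * r) ^ p) * ?_
        refine setLIntegral_mono' hQ₀m fun x hx => ?_
        rw [Pi.mul_apply, mul_comm]
        gcongr
        exact iSup_le fun k => cellDist_cellMean_le_maxSharp hl hf k hx

end Dyadic

/-- local weighted Fefferman–Stein inequality: for `1 < p < ∞`,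
`w ∈ A_∞^d(Q₀)` with constants `Cw, δw` and `f ∈ L¹(Q₀)`,
`∫_{Q₀} |f − f_{Q₀}|^p w dx ≤ C ∫_{Q₀} (M^{d,♯}_{Q₀} f)^p w dx`
with `C = C(n, p, Cw, δw) > 0`. -/
theorem local_weighted_fefferman_stein
    (n : ℕ) (p Cw δw : ℝ) (hp : 1 < p) (hCw : 0 < Cw) (hδw : 0 < δw) :
    ∃ C : ℝ, 0 < C ∧
      ∀ (a : Rn n) (l : ℝ), 0 < l →
      ∀ w : Rn n → ℝ, IntegrableOn w (Cube a l) volume →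
        (∀ᵐ x ∂(volume : Measure (Rn n)), x ∈ Cube a l → 0 < w x) →
        IsAinftyD a l w Cw δw →
      ∀ f : Rn n → ℝ, IntegrableOn f (Cube a l) volume →
        (∫⁻ x in Cube a l,
            (ENNReal.ofReal |f x - ⨍ y in Cube a l, f y|) ^ p * ENNReal.ofReal (w x)) ≤
          ENNReal.ofReal C *
            ∫⁻ x in Cube a l, (MaxSharp a l f x) ^ p * ENNReal.ofReal (w x) := by
  set L : ℝ := max 1 ((2 ^ p * Cw) ^ δw⁻¹)
  have hL1 : 1 ≤ L := le_max_left _ _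
  have hL : 2 ^ p * ENNReal.ofReal Cw ≤ ENNReal.ofReal L ^ δw := by
    rw [ENNReal.ofReal_rpow_of_pos (by positivity), ← ENNReal.ofReal_ofNat 2,
      ENNReal.ofReal_rpow_of_pos two_pos, ← ENNReal.ofReal_mul (by positivity)]
    refine ENNReal.ofReal_le_ofReal ?_
    calc 2 ^ p * Cw = ((2 ^ p * Cw) ^ δw⁻¹) ^ δw :=
          (Real.rpow_inv_rpow (by positivity) hδw.ne').symm
      _ ≤ L ^ δw := Real.rpow_le_rpow (by positivity) (le_max_right _ _) hδw.le
  refine ⟨2 * (2 ^ p * (2 ^ n * L) ^ p), by positivity, ?_⟩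
  intro a l hl w hwint _ hw f hf
  have hC : ENNReal.ofReal (2 * (2 ^ p * (2 ^ n * L) ^ p)) =
      2 * (2 ^ p * (2 ^ n * ENNReal.ofReal L) ^ p) := by
    rw [ENNReal.ofReal_mul two_pos.le, ENNReal.ofReal_mul (by positivity),
      ← ENNReal.ofReal_rpow_of_pos two_pos, ← ENNReal.ofReal_rpow_of_pos (by positivity),
      ENNReal.ofReal_mul (by positivity), ENNReal.ofReal_pow two_pos.le, ENNReal.ofReal_ofNat]
  rw [hC]
  exact lintegral_enorm_sub_average_rpow_le hp.le hδw (ENNReal.one_le_ofReal.2 hL1)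
    ENNReal.ofReal_ne_top hL hl hwint hw hf
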